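/- (Mollified Taylor bound.) Let 𝒪 ⊆ ℝ^n be convex and open, let G ∈ C²(𝒪; ℝ) with uniformly bounded second partial derivatives on 𝒪 (bound M), and let U: 𝒳 → 𝒪 be locally integrable. Then there is C depending only on M and n such that for every ε > 0 and every X ∈ 𝒳_ε, |G(U(X)) − [G(U)]_ε(X) − D_U G(U(X)) · (U(X) − [U]_ε(X))| ≤ C ( |U(X) − U(·)|² ∗_Y η_ε )(X), where the convolution on the right is in the second argument: ( |U(X) − U(·)|² ∗_Y η_ε )(X) = ∫ |U(X) − U(X−Y)|² η_ε(Y) dY. -/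

import Mathlib

open MeasureTheory Set

/-- The standard mollifier `η_ε(X) = ε^{-(k+1)} η₁(X/ε)` built from `η₁`. -/
noncomputable def mollifierKernel (k : ℕ) (η₁ : EuclideanSpace ℝ (Fin (k + 1)) → ℝ)
    (ε : ℝ) (X : EuclideanSpace ℝ (Fin (k + 1))) : ℝ :=
  (ε ^ (k + 1))⁻¹ * η₁ (ε⁻¹ • X)

/-- Mollification `[f]_ε(X) = (f ∗ η_ε)(X) = ∫ η_ε(Y) f(X-Y) dY`
(component-wise for vector valued `f`). -/
noncomputable def mollify (k : ℕ) {F : Type*} [NormedAddCommGroup F] [NormedSpace ℝ F]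
    (η₁ : EuclideanSpace ℝ (Fin (k + 1)) → ℝ) (ε : ℝ)
    (f : EuclideanSpace ℝ (Fin (k + 1)) → F) (X : EuclideanSpace ℝ (Fin (k + 1))) : F :=
  ∫ Y, mollifierKernel k η₁ ε Y • f (X - Y)

/-- First-order Taylor estimate on a convex open set with a bound on the second derivative. -/
theorem Convex.abs_sub_sub_fderivWithin_le {E : Type*} [NormedAddCommGroup E] [NormedSpace ℝ E]
    {s : Set E} (hs : Convex ℝ s) (ho : IsOpen s) {G : E → ℝ} (hG : ContDiffOn ℝ 2 G s) {M : ℝ}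
    (hM : ∀ x ∈ s, ‖iteratedFDerivWithin ℝ 2 G s x‖ ≤ M) {a b : E} (ha : a ∈ s) (hb : b ∈ s) :
    |G a - G b - fderivWithin ℝ G s a (a - b)| ≤ M * ‖a - b‖ ^ 2 := by
  have hu := ho.uniqueDiffOn (𝕜 := ℝ)
  have hM0 : 0 ≤ M := (norm_nonneg _).trans (hM a ha)
  have hdiff : DifferentiableOn ℝ (fderivWithin ℝ G s) s :=
    (hG.fderivWithin hu (m := 1) (by norm_num)).differentiableOn (by norm_num)
  have hlip : ∀ z ∈ s, ‖fderivWithin ℝ G s z - fderivWithin ℝ G s a‖ ≤ M * ‖z - a‖ := by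
    intro z hz
    refine hs.norm_image_sub_le_of_norm_fderivWithin_le (𝕜 := ℝ) hdiff (fun x hx => ?_) ha hz
    rw [← norm_iteratedFDerivWithin_one _ (hu x hx), norm_iteratedFDerivWithin_fderivWithin hu hx]
    exact hM x hx
  have hseg : segment ℝ a b ⊆ s := hs.segment_subset ha hb
  have key := (convex_segment (𝕜 := ℝ) a b).norm_image_sub_le_of_norm_hasFDerivWithin_le'
    (f := G) (f' := fderivWithin ℝ G s) (φ := fderivWithin ℝ G s a) (C := M * ‖b - a‖)
    (fun x hx => ((hG.differentiableOn (by norm_num)) x (hseg hx)).hasFDerivWithinAt.mono hseg)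
    (fun x hx => (hlip x (hseg hx)).trans
      (mul_le_mul_of_nonneg_left (norm_sub_le_of_mem_segment hx) hM0))
    (left_mem_segment ℝ a b) (right_mem_segment ℝ a b)
  rw [Real.norm_eq_abs, ← abs_neg, norm_sub_rev b a] at key
  calc _ = |-(G b - G a - fderivWithin ℝ G s a (b - a))| := by
        congr 1
        rw [← neg_sub a b, map_neg]
        ring
    _ ≤ _ := key.trans_eq (by ring)

section Mollifier

variable {k : ℕ} {η₁ : EuclideanSpace ℝ (Fin (k + 1)) → ℝ} {ε : ℝ}

theorem continuous_mollifierKernel (h : Continuous η₁) (ε : ℝ) :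
    Continuous (mollifierKernel k η₁ ε) := by
  unfold mollifierKernel
  fun_prop

theorem mollifierKernel_nonneg (h : ∀ X, 0 ≤ η₁ X) (hε : 0 < ε)
    (X : EuclideanSpace ℝ (Fin (k + 1))) : 0 ≤ mollifierKernel k η₁ ε X :=
  mul_nonneg (by positivity) (h _)

theorem support_mollifierKernel_subset (h : tsupport η₁ ⊆ Metric.ball 0 1) (hε : 0 < ε) :
    Function.support (mollifierKernel k η₁ ε) ⊆ Metric.closedBall 0 ε := by
  intro X hX
  have h1 : η₁ (ε⁻¹ • X) ≠ 0 := right_ne_zero_of_mul hX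
  have h2 := h (subset_tsupport _ h1)
  rw [mem_ball_zero_iff, norm_smul, norm_inv, Real.norm_of_nonneg hε.le,
    inv_mul_lt_iff₀ hε, mul_one] at h2
  exact mem_closedBall_zero_iff.2 h2.le

theorem integral_mollifierKernel (h : ∫ X, η₁ X = 1) (hε : 0 < ε) :
    ∫ X, mollifierKernel k η₁ ε X = 1 := by
  unfold mollifierKernel
  rw [integral_const_mul, Measure.integral_comp_inv_smul, h, finrank_euclideanSpace_fin,
    abs_of_pos (by positivity), smul_eq_mul, mul_one, inv_mul_cancel₀ (by positivity)]

theorem integrable_mollifierKernel_smul {F : Type*} [NormedAddCommGroup F] [NormedSpace ℝ F]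
    (hc : Continuous η₁) (hsupp : tsupport η₁ ⊆ Metric.ball 0 1) (hε : 0 < ε)
    {f : EuclideanSpace ℝ (Fin (k + 1)) → F} (hf : IntegrableOn f (Metric.closedBall 0 ε)) :
    Integrable fun Y => mollifierKernel k η₁ ε Y • f Y := by
  refine (integrableOn_iff_integrable_of_support_subset
    (f := fun Y => mollifierKernel k η₁ ε Y • f Y) (s := Metric.closedBall 0 ε) ?_).1 ?_
  · exact (Function.support_smul_subset_left _ _).trans (support_mollifierKernel_subset hsupp hε)
  · exact hf.continuousOn_smul (continuous_mollifierKernel hc ε).continuousOn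
      (isCompact_closedBall _ _)

end Mollifier

theorem ContinuousOn.comp_aestronglyMeasurable_of_isOpen {α E F : Type*} [MeasurableSpace α]
    {μ : Measure α} [TopologicalSpace E] [TopologicalSpace.PseudoMetrizableSpace E]
    [MeasurableSpace E] [BorelSpace E] [NormedAddCommGroup F] [MeasurableSpace F] [BorelSpace F]
    [SecondCountableTopology F] {G : E → F} {s : Set E} (hs : IsOpen s) (hG : ContinuousOn G s)
    {u : α → E} (hu : AEStronglyMeasurable u μ) (hus : ∀ᵐ x ∂μ, u x ∈ s) :
    AEStronglyMeasurable (fun x => G (u x)) μ := by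
  classical
  have hm : Measurable (s.piecewise G 0) :=
    hG.measurable_piecewise continuousOn_const hs.measurableSet
  refine (hm.comp_aemeasurable hu.aemeasurable).aestronglyMeasurable.congr ?_
  filter_upwards [hus] with x hx
  simp [hx]

/-- **Mollified Taylor bound.**  Let `𝒪 ⊆ ℝⁿ` be open and convex, `G ∈ C²(𝒪;ℝ)` with
second derivatives bounded by `M` on `𝒪`, and let `U : 𝒳 → 𝒪` be locally integrable.
Then there is `C`, depending only on `M` and `n`, such that for every `ε > 0` and every
`X ∈ 𝒳_ε`,

`|G(U(X)) − [G(U)]_ε(X) − D_U G(U(X))·(U(X) − [U]_ε(X))| ≤ C (|U(X) − U(·)|² ∗_Y η_ε)(X)`.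
-/
theorem mollified_taylor_bound
    (k n : ℕ) (hk : 1 ≤ k) (hn : 1 ≤ n)
    -- the mollifying kernel `η₁`
    (η₁ : EuclideanSpace ℝ (Fin (k + 1)) → ℝ)
    (hη₁smooth : ContDiff ℝ (⊤ : ℕ∞) η₁) (hη₁nonneg : ∀ X, 0 ≤ η₁ X)
    (hη₁supp : tsupport η₁ ⊆ Metric.ball 0 1) (hη₁int : ∫ X, η₁ X = 1)
    -- the bound on the second derivatives of `G`
    (M : ℝ) :
    ∃ C : ℝ, 0 < C ∧
      ∀ (𝒳 : Set (EuclideanSpace ℝ (Fin (k + 1)))), IsOpen 𝒳 →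
      ∀ (𝒪 : Set (EuclideanSpace ℝ (Fin n))), IsOpen 𝒪 → Convex ℝ 𝒪 →
      ∀ G : EuclideanSpace ℝ (Fin n) → ℝ,
        ContDiffOn ℝ 2 G 𝒪 →
        (∀ V ∈ 𝒪, ‖iteratedFDerivWithin ℝ 2 G 𝒪 V‖ ≤ M) →
      ∀ U : EuclideanSpace ℝ (Fin (k + 1)) → EuclideanSpace ℝ (Fin n),
        (∀ X ∈ 𝒳, U X ∈ 𝒪) →
        LocallyIntegrableOn U 𝒳 volume →
      ∀ ε : ℝ, 0 < ε →
      ∀ X : EuclideanSpace ℝ (Fin (k + 1)),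
        -- `X ∈ 𝒳_ε`, i.e. `dist(X, ∂𝒳) > ε`
        Metric.closedBall X ε ⊆ 𝒳 →
        ENNReal.ofReal
            |G (U X) - mollify k η₁ ε (fun Z => G (U Z)) X -
              fderivWithin ℝ G 𝒪 (U X) (U X - mollify k η₁ ε U X)|
          ≤ ENNReal.ofReal C *
            ∫⁻ Y, ENNReal.ofReal (mollifierKernel k η₁ ε Y * ‖U X - U (X - Y)‖ ^ 2) := by
  refine ⟨|M| + 1, by positivity, ?_⟩
  intro 𝒳 _ 𝒪 h𝒪 hconv G hG hM U hU hloc ε hε X hX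
  set κ := mollifierKernel k η₁ ε
  have hc : Continuous η₁ := hη₁smooth.continuous
  have hκc : Continuous κ := continuous_mollifierKernel hc ε
  have hκ0 : ∀ Y, 0 ≤ κ Y := mollifierKernel_nonneg hη₁nonneg hε
  have hκsupp : Function.support κ ⊆ Metric.closedBall 0 ε :=
    support_mollifierKernel_subset hη₁supp hε
  have hκ1 : ∫ Y, κ Y = 1 := integral_mollifierKernel hη₁int hε
  have hκint : Integrable κ := by
    by_contra h
    rw [integral_undef h] at hκ1
    exact zero_ne_one hκ1
  have hmem : ∀ Y ∈ Metric.closedBall (0 : EuclideanSpace ℝ (Fin (k + 1))) ε, X - Y ∈ 𝒳 :=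
    fun Y hY => hX (by simpa [dist_eq_norm] using hY)
  have hUint : IntegrableOn (fun Y => U (X - Y)) (Metric.closedBall 0 ε) := by
    have h := hloc.integrableOn_compact_subset hX (isCompact_closedBall X ε)
    have hpre : (fun Y => X - Y) ⁻¹' Metric.closedBall X ε = Metric.closedBall 0 ε := by
      ext Y
      simp [dist_eq_norm]
    rw [← hpre]
    exact (((Measure.measurePreserving_sub_left volume X).integrableOn_comp_preimage
      (MeasurableEquiv.subLeft X).measurableEmbedding).2 h)
  have hUX : U X ∈ 𝒪 := hU X (hX (Metric.mem_closedBall_self hε.le))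
  set L := fderivWithin ℝ G 𝒪 (U X)
  set R : EuclideanSpace ℝ (Fin (k + 1)) → ℝ :=
    fun Y => G (U X) - G (U (X - Y)) - L (U X - U (X - Y)) with hR
  have hpt : ∀ Y, |κ Y * R Y| ≤ (|M| + 1) * (κ Y * ‖U X - U (X - Y)‖ ^ 2) := by
    intro Y
    by_cases hY : κ Y = 0
    · simp [hY]
    have hT := hconv.abs_sub_sub_fderivWithin_le h𝒪 hG hM hUX (hU _ (hmem Y (hκsupp hY)))
    rw [abs_mul, abs_of_nonneg (hκ0 Y), mul_left_comm]
    refine mul_le_mul_of_nonneg_left (hT.trans ?_) (hκ0 Y)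
    gcongr
    linarith [le_abs_self M]
  have hle : ∫⁻ Y, ENNReal.ofReal |κ Y * R Y| ≤ ENNReal.ofReal (|M| + 1) *
      ∫⁻ Y, ENNReal.ofReal (κ Y * ‖U X - U (X - Y)‖ ^ 2) := by
    rw [← lintegral_const_mul' _ _ ENNReal.ofReal_ne_top]
    refine lintegral_mono fun Y => ?_
    rw [← ENNReal.ofReal_mul (by positivity)]
    exact ENNReal.ofReal_le_ofReal (hpt Y)
  by_cases htop : ∫⁻ Y, ENNReal.ofReal |κ Y * R Y| = ⊤
  · rw [htop, top_le_iff] at hle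
    rw [hle]
    exact le_top
  have hκU : Integrable fun Y => κ Y • U (X - Y) :=
    integrable_mollifierKernel_smul hc hη₁supp hε hUint
  have hκGm : AEStronglyMeasurable (fun Y => κ Y * G (U (X - Y))) volume := by
    have h1 : AEStronglyMeasurable (fun Y => G (U (X - Y)))
        (volume.restrict (Metric.closedBall 0 ε)) :=
      hG.continuousOn.comp_aestronglyMeasurable_of_isOpen h𝒪 hUint.aestronglyMeasurable
        ((ae_restrict_iff' measurableSet_closedBall).2 (.of_forall fun Y hY => hU _ (hmem Y hY)))
    have h2 := hκc.aestronglyMeasurable.mul h1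
    refine ((aestronglyMeasurable_indicator_iff measurableSet_closedBall).2 h2).congr
      (.of_forall fun Y => ?_)
    exact congrFun (indicator_eq_self.2
      ((Function.support_mul_subset_left _ _).trans hκsupp)) Y
  have hκL : Integrable fun Y => L (κ Y • (U X - U (X - Y))) := by
    refine L.integrable_comp ?_
    simp only [smul_sub]
    exact (hκint.smul_const _).sub hκU
  have hexp : ∀ Y, κ Y * R Y =
      κ Y * G (U X) - κ Y * G (U (X - Y)) - L (κ Y • (U X - U (X - Y))) := by
    intro Y
    simp only [hR, map_smul, smul_eq_mul]
    ring
  have hκR : Integrable fun Y => κ Y * R Y := by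
    refine ⟨?_, ?_⟩
    · simp only [hexp]
      exact ((hκint.mul_const _).aestronglyMeasurable.sub hκGm).sub hκL.aestronglyMeasurable
    · rw [hasFiniteIntegral_iff_norm]
      exact lt_top_iff_ne_top.2 htop
  have hκG : Integrable fun Y => κ Y * G (U (X - Y)) := by
    refine (((hκint.mul_const (G (U X))).sub hκL).sub hκR).congr (.of_forall fun Y => ?_)
    simp only [Pi.sub_apply, hexp]
    ring
  have hmain : G (U X) - mollify k η₁ ε (fun Z => G (U Z)) X - L (U X - mollify k η₁ ε U X) =
      ∫ Y, κ Y * R Y := by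
    simp only [hexp]
    have hsub : Integrable fun Y => κ Y * G (U X) - κ Y * G (U (X - Y)) :=
      (hκint.mul_const _).sub hκG
    rw [integral_sub hsub hκL, integral_sub (hκint.mul_const _) hκG,
      integral_mul_const, hκ1, one_mul, L.integral_comp_comm]
    · simp only [smul_sub]
      rw [integral_sub (hκint.smul_const _) hκU, integral_smul_const, hκ1, one_smul]
      rfl
    · simp only [smul_sub]
      exact (hκint.smul_const _).sub hκU
  rw [hmain]
  refine le_trans ?_ hle
  simp only [← Real.enorm_eq_ofReal_abs]
  exact enorm_integral_le_lintegral_enorm _
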